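/- Let (x_n), (a_n), (λ_n) be generated by Algorithm 1.1 for a nonempty closed convex set Z ⊆ H and x₀ ∈ L²(Ω,ℱ,P;H), with each x_n square-integrable, and set 𝒳_n = σ(x₀,…,x_n). Then Σ_{n∈ℕ} E[λ_n² ‖a_n − x_n‖²] < +∞, and P-almost surely Σ_{n∈ℕ} E[λ_n² ‖a_n − x_n‖² | 𝒳_n] < +∞. -/

import Mathlib

open MeasureTheory Filter RealInnerProductSpace Topology

/-- The half-space `H(x,y) = {z : ⟪z - y, x - y⟫ ≤ 0}`. -/
def halfSpace {H : Type*} [NormedAddCommGroup H] [InnerProductSpace ℝ H] (x y : H) : Set H :=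
  {z : H | ⟪z - y, x - y⟫ ≤ 0}

open scoped Classical in
/-- The outer set `O(x,y,z)`. -/
noncomputable def Oset {H : Type*} [NormedAddCommGroup H] [InnerProductSpace ℝ H]
    (x y z : H) : Set H :=
  if (halfSpace x y ∩ halfSpace y z).Nonempty then halfSpace x y ∩ halfSpace y z else {y}

/-- `q` is the metric projection of `x` onto `C`. -/
def IsProjPt {H : Type*} [NormedAddCommGroup H] [InnerProductSpace ℝ H]
    (C : Set H) (x q : H) : Prop :=
  q ∈ C ∧ ∀ w ∈ C, ‖x - q‖ ≤ ‖x - w‖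

lemma convex_halfSpace {H : Type*} [NormedAddCommGroup H] [InnerProductSpace ℝ H] (x y : H) :
    Convex ℝ (halfSpace x y) := by
  intro u hu v hv s t hs ht hst
  simp only [halfSpace, Set.mem_ofPred_eq] at *
  have h : s • u + t • v - y = s • (u - y) + t • (v - y) := by
    rw [smul_sub, smul_sub, sub_add_sub_comm, ← add_smul, hst, one_smul]
  rw [h, inner_add_left, real_inner_smul_left, real_inner_smul_left]
  nlinarith

lemma halfSpace_subset_halfSpace_relaxed {H : Type*} [NormedAddCommGroup H]
    [InnerProductSpace ℝ H] (x a : H) {t : ℝ} (ht : t ∈ Set.Ioc (0 : ℝ) 1) :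
    halfSpace x a ⊆ halfSpace x (x + t • (a - x)) := by
  intro z hz
  simp only [halfSpace, Set.mem_ofPred_eq] at *
  have h₁ : z - (x + t • (a - x)) = (z - a) - (1 - t) • (x - a) := by module
  have h₂ : x - (x + t • (a - x)) = t • (x - a) := by module
  rw [h₁, h₂, inner_sub_left, real_inner_smul_right, real_inner_smul_left,
    real_inner_smul_right, real_inner_self_eq_norm_sq]
  have h₃ : 0 ≤ (1 - t) * (t * ‖x - a‖ ^ 2) :=
    mul_nonneg (sub_nonneg.2 ht.2) (mul_nonneg ht.1.le (sq_nonneg _))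
  nlinarith [ht.1]

lemma norm_sq_add_norm_sq_le_of_mem_halfSpace {H : Type*} [NormedAddCommGroup H]
    [InnerProductSpace ℝ H] {x y z : H} (hz : z ∈ halfSpace x y) :
    ‖x - y‖ ^ 2 + ‖y - z‖ ^ 2 ≤ ‖x - z‖ ^ 2 := by
  simp only [halfSpace, Set.mem_ofPred_eq] at hz
  have h : x - z = (x - y) - (z - y) := by abel
  rw [h, norm_sub_sq_real (x - y), real_inner_comm, norm_sub_rev y z]
  linarith

lemma IsProjPt.subset_halfSpace {H : Type*} [NormedAddCommGroup H] [InnerProductSpace ℝ H]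
    {C : Set H} (hC : Convex ℝ C) {x q : H} (h : IsProjPt C x q) : C ⊆ halfSpace x q := by
  have : Nonempty C := ⟨⟨q, h.1⟩⟩
  have hinf : ‖x - q‖ = ⨅ w : C, ‖x - w‖ :=
    le_antisymm (le_ciInf fun w => h.2 w w.2)
      (ciInf_le ⟨0, by rintro _ ⟨w, rfl⟩; exact norm_nonneg _⟩ (⟨q, h.1⟩ : C))
  intro w hw
  rw [halfSpace, Set.mem_ofPred_eq, real_inner_comm]
  exact (norm_eq_iInf_iff_real_inner_le_zero hC h.1).1 hinf w hw

/-- Along a deterministic trajectory the squared relaxed steps have partial sums at most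
`‖x 0 - z‖ ^ 2`, for any `z ∈ Z`. -/
lemma sum_relaxed_steps_le {H : Type*} [NormedAddCommGroup H] [InnerProductSpace ℝ H]
    {Z : Set H} {x a r : ℕ → H} {t : ℕ → ℝ}
    (haZ : ∀ n, Z ⊆ halfSpace (x n) (a n)) (ht : ∀ n, t n ∈ Set.Ioc (0 : ℝ) 1)
    (hr : ∀ n, r n = x n + t n • (a n - x n))
    (hx : ∀ n, IsProjPt (Oset (x 0) (x n) (r n)) (x 0) (x (n + 1)))
    {z : H} (hz : z ∈ Z) (N : ℕ) :
    ∑ n ∈ Finset.range N, t n ^ 2 * ‖a n - x n‖ ^ 2 ≤ ‖x 0 - z‖ ^ 2 := by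
  have hrZ n : Z ⊆ halfSpace (x n) (r n) :=
    (haZ n).trans (hr n ▸ halfSpace_subset_halfSpace_relaxed _ _ (ht n))
  have hO n (h : Z ⊆ halfSpace (x 0) (x n)) :
      Oset (x 0) (x n) (r n) = halfSpace (x 0) (x n) ∩ halfSpace (x n) (r n) :=
    if_pos ⟨z, h hz, hrZ n hz⟩
  have hxZ n : Z ⊆ halfSpace (x 0) (x n) := by
    induction n with
    | zero => intro w _; simp [halfSpace]
    | succ n ih =>
      have h := hx n
      rw [hO n ih] at h
      exact (Set.subset_inter ih (hrZ n)).trans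
        (h.subset_halfSpace ((convex_halfSpace _ _).inter (convex_halfSpace _ _)))
  have hstep n : t n ^ 2 * ‖a n - x n‖ ^ 2 ≤ ‖x 0 - x (n + 1)‖ ^ 2 - ‖x 0 - x n‖ ^ 2 := by
    have h := (hx n).1
    rw [hO n (hxZ n)] at h
    have h₁ := norm_sq_add_norm_sq_le_of_mem_halfSpace h.1
    have h₂ := norm_sq_add_norm_sq_le_of_mem_halfSpace h.2
    have h₃ : ‖x n - r n‖ ^ 2 = t n ^ 2 * ‖a n - x n‖ ^ 2 := by
      rw [hr, sub_add_cancel_left, norm_neg, norm_smul, mul_pow, Real.norm_eq_abs, sq_abs]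
    nlinarith [sq_nonneg ‖r n - x (n + 1)‖]
  calc ∑ n ∈ Finset.range N, t n ^ 2 * ‖a n - x n‖ ^ 2
      ≤ ∑ n ∈ Finset.range N, (‖x 0 - x (n + 1)‖ ^ 2 - ‖x 0 - x n‖ ^ 2) :=
        Finset.sum_le_sum fun n _ => hstep n
    _ = ‖x 0 - x N‖ ^ 2 := by rw [Finset.sum_range_sub (fun n => ‖x 0 - x n‖ ^ 2)]; simp
    _ ≤ ‖x 0 - z‖ ^ 2 := by
        nlinarith [norm_sq_add_norm_sq_le_of_mem_halfSpace (hxZ N hz), sq_nonneg ‖x N - z‖]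

lemma ae_summable_of_summable_integral {Ω : Type*} [MeasurableSpace Ω] {μ : Measure Ω}
    {g : ℕ → Ω → ℝ} (hint : ∀ n, Integrable (g n) μ) (hnonneg : ∀ n, 0 ≤ᵐ[μ] g n)
    (hsum : Summable fun n => ∫ ω, g n ω ∂μ) : ∀ᵐ ω ∂μ, Summable fun n => g n ω := by
  have hfin : ∫⁻ ω, ∑' n, ENNReal.ofReal (g n ω) ∂μ ≠ ⊤ := by
    rw [lintegral_tsum fun n => (hint n).aemeasurable.ennreal_ofReal]
    simp_rw [← ofReal_integral_eq_lintegral_ofReal (hint _) (hnonneg _)]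
    exact hsum.tsum_ofReal_ne_top
  have hmeas : AEMeasurable (fun ω => ∑' n, ENNReal.ofReal (g n ω)) μ :=
    AEMeasurable.tsum fun n => (hint n).aemeasurable.ennreal_ofReal
  filter_upwards [ae_lt_top' hmeas hfin, ae_all_iff.2 hnonneg] with ω hω hpos
  refine (ENNReal.summable_toReal hω.ne).congr fun n => ENNReal.toReal_ofReal (hpos n)

/-- Theorem 3.1(vi): summability of `E[λₙ²‖aₙ - xₙ‖²]` and of the conditional expectations. -/
theorem haugazeau_summable_relaxed_steps
    {Ω : Type*} [MeasurableSpace Ω] (μ : Measure Ω)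
    [IsProbabilityMeasure μ] [μ.IsComplete]
    {H : Type*} [NormedAddCommGroup H] [InnerProductSpace ℝ H] [CompleteSpace H]
    [SecondCountableTopology H] [MeasurableSpace H] [BorelSpace H]
    (Z : Set H) (hZne : Z.Nonempty) (hZcl : IsClosed Z) (hZconv : Convex ℝ Z)
    (x a r : ℕ → Ω → H) (lam : ℕ → Ω → ℝ)
    (hx0 : MemLp (x 0) 2 μ)
    (hxL2 : ∀ n, MemLp (x n) 2 μ)
    (ha : ∀ n, MemLp (a n) 2 μ)
    (haZ : ∀ n, ∀ᵐ ω ∂μ, Z ⊆ halfSpace (x n ω) (a n ω))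
    (hlam_meas : ∀ n, Measurable (lam n))
    (hlam : ∀ n ω, lam n ω ∈ Set.Ioc (0 : ℝ) 1)
    (hr : ∀ n ω, r n ω = x n ω + lam n ω • (a n ω - x n ω))
    (hxsucc : ∀ n ω, IsProjPt (Oset (x 0 ω) (x n ω) (r n ω)) (x 0 ω) (x (n + 1) ω))
    (pZ : H → H) (hpZ : ∀ v : H, IsProjPt Z v (pZ v))
    (𝒳 : ℕ → MeasurableSpace Ω)
    (h𝒳 : ∀ n, 𝒳 n = ⨆ i : Fin (n + 1), MeasurableSpace.comap (x i) inferInstance) :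
    Summable (fun n => ∫ ω, lam n ω ^ 2 * ‖a n ω - x n ω‖ ^ 2 ∂μ) ∧
    ∀ᵐ ω ∂μ, Summable fun n =>
      (μ[(fun ω' => lam n ω' ^ 2 * ‖a n ω' - x n ω'‖ ^ 2) | 𝒳 n]) ω := by
  have hint n : Integrable (fun ω => lam n ω ^ 2 * ‖a n ω - x n ω‖ ^ 2) μ := by
    refine ((ha n).sub (hxL2 n)).integrable_norm_pow two_ne_zero |>.bdd_mul (c := 1)
      ((hlam_meas n).pow_const 2).aestronglyMeasurable (ae_of_all _ fun ω => ?_)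
    rw [norm_pow, Real.norm_eq_abs, abs_of_pos (hlam n ω).1]
    exact pow_le_one₀ (hlam n ω).1.le (hlam n ω).2
  have hnonneg n : 0 ≤ fun ω => lam n ω ^ 2 * ‖a n ω - x n ω‖ ^ 2 := fun ω => by positivity
  have hsum : Summable fun n => ∫ ω, lam n ω ^ 2 * ‖a n ω - x n ω‖ ^ 2 ∂μ := by
    obtain ⟨z, hz⟩ := hZne
    refine summable_of_sum_range_le (c := ∫ ω, ‖x 0 ω - z‖ ^ 2 ∂μ)
      (fun n => integral_nonneg (hnonneg n)) fun N => ?_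
    rw [← integral_finsetSum _ fun n _ => hint n]
    refine integral_mono_ae (integrable_finsetSum _ fun n _ => hint n)
      ((hx0.sub (memLp_const z)).integrable_norm_pow two_ne_zero) ?_
    filter_upwards [ae_all_iff.2 haZ] with ω hω
    exact sum_relaxed_steps_le hω (fun n => hlam n ω) (fun n => hr n ω)
      (fun n => hxsucc n ω) hz N
  refine ⟨hsum, ae_summable_of_summable_integral (fun n => integrable_condExp)
    (fun n => condExp_nonneg (ae_of_all _ (hnonneg n))) ?_⟩
  have hle n : 𝒳 n ≤ ‹MeasurableSpace Ω› := by
    rw [h𝒳]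
    exact iSup_le fun i =>
      (hxL2 i).aestronglyMeasurable.aemeasurable.nullMeasurable.measurable_of_complete.comap_le
  exact hsum.congr fun n => (integral_condExp (hle n)).symm
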